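/- The smallest subset of Q containing {a, b, c} and closed under the six maps x ↦ x ▷ a, x ▷ b, x ▷ c, x ▷⁻¹ a, x ▷⁻¹ b, x ▷⁻¹ c has at most 2nt + 2 elements. (This is the upper-bound half of the theorem that |Q_{(2,2,n)}(L_k)| = n|k| + 2 for k = 2t even, k ≠ 0.) -/

import Mathlib

/-- A quandle in the paper's (right-action) conventions: `op x y` is `x ▷ y` (written `x^y`)
and `inv x y` is `x ▷⁻¹ y` (written `x^{ȳ}`). -/
structure LinkQuandle (Q : Type*) where
  op : Q → Q → Q
  inv : Q → Q → Q
  idem : ∀ x, op x x = x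
  inv_op : ∀ x y, inv (op x y) y = x
  op_inv : ∀ x y, op (inv x y) y = x
  distrib : ∀ x y z, op (op x y) z = op (op x z) (op y z)

/-- `opPow q y n x` is `x^{yⁿ}`: act on `x` by `y`, `n` times. -/
def LinkQuandle.opPow {Q : Type*} (q : LinkQuandle Q) (y : Q) (n : ℕ) (x : Q) : Q :=
  (fun z => q.op z y)^[n] x

/-- `pairPow q y z t x` is `x^{(yz)^t}`: act on `x` by `y` then `z`, `t` times. -/
def LinkQuandle.pairPow {Q : Type*} (q : LinkQuandle Q) (y z : Q) (t : ℕ) (x : Q) : Q :=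
  (fun w => q.op (q.op w y) z)^[t] x

/-- The smallest subset of `Q` containing `S` and closed under acting (and inversely acting)
by every element of `S`. -/
def LinkQuandle.genClosure {Q : Type*} (q : LinkQuandle Q) (S : Set Q) : Set Q :=
  ⋂₀ {T : Set Q | S ⊆ T ∧ ∀ x ∈ T, ∀ s ∈ S, q.op x s ∈ T ∧ q.inv x s ∈ T}

namespace LinkQuandle

variable {Q : Type*} (q : LinkQuandle Q)

/-- The permutation `x ↦ x ▷ y`. -/
def right (y : Q) : Equiv.Perm Q := ⟨fun x => q.op x y, fun x => q.inv x y, fun x => q.inv_op x y,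
  fun x => q.op_inv x y⟩

/-- The permutations `g` of `Q` that conjugate `x ↦ x ▷ y` to `x ↦ x ▷ g y`, that is, the
permutations preserving `▷`. -/
def autSubmonoid : Submonoid (Equiv.Perm Q) where
  carrier := {g | ∀ y, SemiconjBy g (q.right y) (q.right (g y))}
  one_mem' _ := SemiconjBy.one_left _
  mul_mem' hg hh y := (hg _).mul_left (hh y)

theorem right_mem_autSubmonoid (z : Q) : q.right z ∈ q.autSubmonoid :=
  fun y => Equiv.ext fun x => q.distrib x y z

variable {q} in
theorem commute_right_of_fixed {g : Equiv.Perm Q} (hg : g ∈ q.autSubmonoid) {y : Q}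
    (hy : g y = y) : Commute g (q.right y) := by
  have := hg y
  rwa [hy] at this

theorem opPow_eq (y : Q) (n : ℕ) (x : Q) : q.opPow y n x = (q.right y ^ n) x := by
  rw [Equiv.Perm.coe_pow]; rfl

theorem pairPow_eq (y z : Q) (t : ℕ) (x : Q) :
    q.pairPow y z t x = ((q.right z * q.right y) ^ t) x := by
  rw [Equiv.Perm.coe_pow]; rfl

theorem genClosure_subset {S T : Set Q} (hS : S ⊆ T)
    (hT : ∀ s ∈ S, ∀ x ∈ T, q.right s x ∈ T ∧ (q.right s)⁻¹ x ∈ T) : q.genClosure S ⊆ T :=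
  Set.sInter_subset_of_mem ⟨hS, fun x hx s hs => hT s hs x hx⟩

end LinkQuandle

/-- The orbit of a point under the integer powers of a permutation whose `N`-th power fixes it. -/
theorem Equiv.Perm.range_zpow_apply_subset {α : Type*} [DecidableEq α] (g : Equiv.Perm α) (y : α)
    {N : ℕ} (hN : 0 < N) (hy : (g ^ N) y = y) :
    (Set.range fun i : ℤ => (g ^ i) y) ⊆ ((Finset.range N).image fun i => (g ^ i) y) := by
  rintro _ ⟨i, rfl⟩
  have hN' : (N : ℤ) ≠ 0 := by positivity
  have h0 := Int.emod_nonneg i hN'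
  have h1 := Int.emod_lt_of_pos i (by positivity : (0 : ℤ) < N)
  simp only [Finset.coe_image, Set.mem_image, Finset.coe_range, Set.mem_Iio]
  refine ⟨(i % N).toNat, by omega, ?_⟩
  rw [← zpow_natCast, Int.toNat_of_nonneg h0]
  conv_rhs => rw [← Int.emod_add_mul_ediv i N, zpow_add, zpow_mul, zpow_natCast]
  rw [Equiv.Perm.mul_apply, Equiv.Perm.zpow_apply_eq_self_of_apply_eq_self hy]

section Orbit

variable {α : Type*} {R C : Equiv.Perm α} {y : α} {t : ℕ}

theorem Commute.apply_zpow_of_fixed (hRC : Commute R C) (hy : C ((R ^ t) y) = y) (i : ℤ) :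
    C ((R ^ i) y) = (R ^ (i - t)) y := by
  have h := congrArg (R ^ (i - t)) hy
  rw [← Equiv.Perm.mul_apply, ((hRC.zpow_left (i - t)).eq), Equiv.Perm.mul_apply,
    ← zpow_natCast, ← Equiv.Perm.mul_apply (R ^ _) (R ^ _), ← zpow_add] at h
  simpa using h

theorem Commute.inv_apply_zpow_of_fixed (hRC : Commute R C) (hy : C ((R ^ t) y) = y) (i : ℤ) :
    C⁻¹ ((R ^ i) y) = (R ^ (i + t)) y := by
  rw [Equiv.Perm.inv_eq_iff_eq, hRC.apply_zpow_of_fixed hy]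
  simp

theorem Commute.pow_apply_of_fixed (hRC : Commute R C) (hy : C ((R ^ t) y) = y) {n : ℕ}
    (hC : C ^ n = 1) : (R ^ (n * t)) y = y := by
  have h : ((C * R ^ t) ^ n) y = y := Equiv.Perm.pow_apply_eq_self_of_apply_eq_self hy n
  rwa [((hRC.pow_left t).symm.mul_pow n), hC, one_mul, ← pow_mul, mul_comm] at h

end Orbit

/-- In a dihedral group generated by the involutions `A` and `B`, the reflection `A` acts on the
orbit of `y` under the rotations `B * A`. -/
theorem Equiv.Perm.apply_zpow_mul {α : Type*} {A B : Equiv.Perm α} (hA : A * A = 1)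
    (hB : B * B = 1) (i : ℤ) (y : α) : A (((B * A) ^ i) y) = ((B * A) ^ (-i)) (A y) := by
  have h : SemiconjBy A (B * A) (B * A)⁻¹ := by
    rw [SemiconjBy, mul_inv_rev, inv_eq_of_mul_eq_one_left hA, inv_eq_of_mul_eq_one_left hB,
      mul_assoc]
  rw [zpow_neg, ← inv_zpow]
  exact DFunLike.congr_fun (h.zpow_right i).eq y

theorem stmt13 {Q : Type*} (q : LinkQuandle Q) (a b c : Q) (n t : ℕ)
    (hn : 2 ≤ n) (ht : 1 ≤ t)
    (h1 : q.op (q.op c a) b = c)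
    (h2 : q.op (q.op (q.pairPow b a (t - 1) a) b) c = a)
    (h3 : q.op (q.pairPow a b t b) c = b)
    (ha : ∀ x : Q, q.op (q.op x a) a = x)
    (hb : ∀ x : Q, q.op (q.op x b) b = x)
    (hc : ∀ x : Q, q.opPow c n x = x) :
    (q.genClosure {a, b, c}).Finite ∧
    (q.genClosure {a, b, c}).ncard ≤ 2 * n * t + 2 := by
  classical
  set A := q.right a
  set B := q.right b
  set C := q.right c with hCdef
  have hA : A * A = 1 := Equiv.ext ha
  have hB : B * B = 1 := Equiv.ext hb
  have hC : C ^ n = 1 := Equiv.ext fun x => by rw [hCdef, ← q.opPow_eq]; exact hc x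
  have hAinv : A⁻¹ = A := inv_eq_of_mul_eq_one_left hA
  have hBinv : B⁻¹ = B := inv_eq_of_mul_eq_one_left hB
  have hAa : A a = a := q.idem a
  have hBb : B b = b := q.idem b
  have hCc : C c = c := q.idem c
  have hRaut : B * A ∈ q.autSubmonoid :=
    mul_mem (q.right_mem_autSubmonoid b) (q.right_mem_autSubmonoid a)
  have hrefl := Equiv.Perm.apply_zpow_mul hA hB
  have hRinv : (B * A)⁻¹ = A * B := by rw [mul_inv_rev, hAinv, hBinv]
  have hBRA : B = B * A * A := by rw [mul_assoc, hA, mul_one]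
  set R := B * A with hR
  have hRc : R c = c := h1
  have hRC : Commute R C := LinkQuandle.commute_right_of_fixed hRaut hRc
  have hBapp (x : Q) : B x = R (A x) := DFunLike.congr_fun hBRA x
  have hya : C ((R ^ t) a) = a := by
    have h : C (B (((A * B) ^ (t - 1)) a)) = a := by rwa [q.pairPow_eq] at h2
    rw [← hRinv, hBapp, inv_pow, ← zpow_natCast, ← zpow_neg, hrefl, hAa, ← Equiv.Perm.mul_apply R,
      neg_neg, zpow_natCast, ← pow_succ', Nat.sub_add_cancel ht] at h
    exact h
  have hyb : C ((R ^ t) b) = b := by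
    rw [q.pairPow_eq] at h3; exact h3
  have hAb : A b = (R ^ (-1 : ℤ)) b := by
    rw [zpow_neg_one, hRinv, Equiv.Perm.mul_apply, hBb]
  have hAAapp (x : Q) : A (A x) = x := ha x
  have hBc : B c = A c := by
    conv_lhs => rw [← hRc, hR, Equiv.Perm.mul_apply]
    exact hb _
  have hBA : B (A c) = c := h1
  have hCA : C (A c) = A c := by
    have h := DFunLike.congr_fun (LinkQuandle.commute_right_of_fixed
      (mul_mem (q.right_mem_autSubmonoid c) (pow_mem hRaut t)) hya).eq c
    have hRt : (R ^ t) c = c := Equiv.Perm.pow_apply_eq_self_of_apply_eq_self hRc t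
    have hRt' : (R ^ t) (A c) = A c := by
      have := hrefl (-t) c
      rw [neg_neg, zpow_natCast, Equiv.Perm.zpow_apply_eq_self_of_apply_eq_self hRc] at this
      exact this.symm
    change C ((R ^ t) (A c)) = A (C ((R ^ t) c)) at h
    rwa [hRt', hRt, hCc] at h
  have hpos : 0 < n * t := by positivity
  let F (y : Q) : Finset Q := (Finset.range (n * t)).image fun i => (R ^ i) y
  have hFa := R.range_zpow_apply_subset a hpos (hRC.pow_apply_of_fixed hya hC)
  have hFb := R.range_zpow_apply_subset b hpos (hRC.pow_apply_of_fixed hyb hC)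
  let T : Set Q := {c, A c} ∪ ((Set.range fun i : ℤ => (R ^ i) a) ∪
    Set.range fun i : ℤ => (R ^ i) b)
  have hTa (i : ℤ) : (R ^ i) a ∈ T := Or.inr (Or.inl ⟨i, rfl⟩)
  have hTb (i : ℤ) : (R ^ i) b ∈ T := Or.inr (Or.inr ⟨i, rfl⟩)
  have hTc : c ∈ T := Or.inl (Or.inl rfl)
  have hTAc : A c ∈ T := Or.inl (Or.inr rfl)
  have hTA : ∀ x ∈ T, A x ∈ T := by
    rintro _ ((rfl | rfl) | (⟨i, rfl⟩ | ⟨i, rfl⟩))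
    · exact hTAc
    · rwa [hAAapp]
    · simpa only [hrefl, hAa] using hTa _
    · simpa only [hrefl, hAb, ← Equiv.Perm.mul_apply, ← zpow_add] using hTb _
  have hTR : ∀ x ∈ T, R x ∈ T := by
    rintro _ ((rfl | rfl) | (⟨i, rfl⟩ | ⟨i, rfl⟩))
    · rwa [hRc]
    · rwa [hR, Equiv.Perm.mul_apply, hAAapp, hBc]
    · simpa only [← Equiv.Perm.mul_apply, ← zpow_one_add] using hTa (1 + i)
    · simpa only [← Equiv.Perm.mul_apply, ← zpow_one_add] using hTb (1 + i)
  have hTB : ∀ x ∈ T, B x ∈ T := fun x hx => hBapp x ▸ hTR _ (hTA x hx)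
  have hTC : ∀ x ∈ T, C x ∈ T ∧ C⁻¹ x ∈ T := by
    rintro _ ((rfl | rfl) | (⟨i, rfl⟩ | ⟨i, rfl⟩))
    · exact ⟨hCc.symm ▸ hTc, (Equiv.Perm.inv_eq_iff_eq.2 hCc.symm).symm ▸ hTc⟩
    · exact ⟨hCA.symm ▸ hTAc, (Equiv.Perm.inv_eq_iff_eq.2 hCA.symm).symm ▸ hTAc⟩
    · simpa only [hRC.apply_zpow_of_fixed hya, hRC.inv_apply_zpow_of_fixed hya] using
        And.intro (hTa _) (hTa _)
    · simpa only [hRC.apply_zpow_of_fixed hyb, hRC.inv_apply_zpow_of_fixed hyb] using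
        And.intro (hTb _) (hTb _)
  have hsub : q.genClosure {a, b, c} ⊆ T := by
    apply q.genClosure_subset
    · rintro _ (rfl | rfl | rfl)
      exacts [hTa 0, hTb 0, hTc]
    · rintro _ (rfl | rfl | rfl) x hx
      · exact ⟨hTA x hx, hAinv.symm ▸ hTA x hx⟩
      · exact ⟨hTB x hx, hBinv.symm ▸ hTB x hx⟩
      · exact hTC x hx
  have hTF : T ⊆ (({c, A c} ∪ (F a ∪ F b) : Finset Q) : Set Q) := by
    rw [Finset.coe_union, Finset.coe_union, Finset.coe_pair]
    exact Set.union_subset_union_right _ (Set.union_subset_union hFa hFb)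
  have hF (y : Q) : (F y).card ≤ n * t := Finset.card_image_le.trans_eq (Finset.card_range _)
  refine ⟨(Finset.finite_toSet _).subset (hsub.trans hTF), ?_⟩
  calc (q.genClosure {a, b, c}).ncard
      ≤ ({c, A c} ∪ (F a ∪ F b) : Finset Q).card := by
        rw [← Set.ncard_coe_finset]
        exact Set.ncard_le_ncard (hsub.trans hTF) (Finset.finite_toSet _)
    _ ≤ 2 + (n * t + n * t) := (Finset.card_union_le _ _).trans (add_le_add Finset.card_le_two
        ((Finset.card_union_le _ _).trans (add_le_add (hF a) (hF b))))
    _ = 2 * n * t + 2 := by ring
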